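/- arXiv:1203.0257 — 15 statements merged into one kernel-verified Lean document; each statement's English description precedes it below -/
import Mathlib

section
/- Let n be a positive integer, let A be a subset of ℝ₊ⁿ (where ℝ₊ = [0,∞) and ℝ₊ⁿ carries the componentwise partial order), and let Φ : A → ℝ₊ be an isotone function. Then the following are equivalent: (i) there exists an isotone function Ψ : ℝ₊ⁿ → ℝ₊ whose restriction to A equals Φ; (ii) for every b ∈ ℝ₊ⁿ, the set {Φ(x) : x ∈ A, x ≤ b} is bounded above (equivalently, sup{Φ(x) : x ∈ A ∩ b^∇} < ∞, where b^∇ = {x ∈ ℝ₊ⁿ : x ≤ b} is the lower cone of b). -/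
open scoped NNReal

/-- Lemma 2.2. Let `A ⊆ ℝ₊ⁿ` and `Φ : A → ℝ₊` isotone. Then `Φ` has an
isotone continuation to all of `ℝ₊ⁿ` iff for every `b` the set `{Φ x : x ∈ A, x ≤ b}` is
bounded above. -/
theorem stmt_0 (n : ℕ) (hn : 0 < n) (A : Set (Fin n → ℝ≥0))
    (Φ : (Fin n → ℝ≥0) → ℝ≥0) (hΦ : MonotoneOn Φ A) :
    (∃ Ψ : (Fin n → ℝ≥0) → ℝ≥0, Monotone Ψ ∧ ∀ x ∈ A, Ψ x = Φ x) ↔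
      ∀ b : Fin n → ℝ≥0, BddAbove (Φ '' {x ∈ A | x ≤ b}) := by
  constructor
  · rintro ⟨Ψ, hm, he⟩ b
    refine ⟨Ψ b, ?_⟩
    rintro _ ⟨x, ⟨hx, hxb⟩, rfl⟩
    rw [← he x hx]
    exact hm hxb
  · intro h
    refine ⟨fun b => sSup (Φ '' {x ∈ A | x ≤ b}), ?_, ?_⟩
    · intro a b hab
      refine csSup_le' ?_
      rintro _ ⟨x, ⟨hx, hxa⟩, rfl⟩
      exact le_csSup (h b) ⟨x, ⟨hx, hxa.trans hab⟩, rfl⟩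
    · intro a ha
      apply le_antisymm
      · refine csSup_le' ?_
        rintro _ ⟨x, ⟨hx, hxa⟩, rfl⟩
        exact hΦ hx ha hxa
      · exact le_csSup (h a) ⟨a, ⟨ha, le_rfl⟩, rfl⟩
end

section
/- Let n be a positive integer, let A ⊆ ℝ₊ⁿ with 0̄ = (0,…,0) ∈ A, and let Φ : A → ℝ₊ be an isotone amenable function such that sup{Φ(x) : x ∈ A, x ≤ b} < ∞ for every b ∈ ℝ₊ⁿ. Define Φ* : ℝ₊ⁿ → ℝ₊ by Φ*(y) = sup{Φ(x) : x ∈ A, x ≤ y} (with sup ∅ = 0). Then Φ* is amenable if and only if for every j₀ ∈ {1,…,n} and every ε > 0 there exists t with 0 < t ≤ ε such that the vector t̄^{j₀} (whose j₀-th coordinate is t and all other coordinates are 0) belongs to A. -/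
open scoped NNReal

/-- Lemma 2.5. Let `A ⊆ ℝ₊ⁿ` contain `0̄` and let `Φ : A → ℝ₊` be isotone
and amenable with `sup {Φ x : x ∈ A, x ≤ b} < ∞` for every `b`. Define
`Φ* y = sup {Φ x : x ∈ A, x ≤ y}` (with `sup ∅ = 0`). Then `Φ*` is amenable iff for every
coordinate `j₀` and every `ε > 0` there is `0 < t ≤ ε` with the vector `t̄^{j₀}`
(having `t` in the `j₀`-th coordinate and `0` elsewhere) in `A`. -/
theorem stmt_1 (n : ℕ) (hn : 0 < n) (A : Set (Fin n → ℝ≥0))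
    (h0A : (0 : Fin n → ℝ≥0) ∈ A)
    (Φ : (Fin n → ℝ≥0) → ℝ≥0) (hΦ : MonotoneOn Φ A)
    (hamen : Φ 0 = 0 ∧ ∀ x ∈ A, x ≠ 0 → 0 < Φ x)
    (hbdd : ∀ b : Fin n → ℝ≥0, BddAbove (Φ '' {x ∈ A | x ≤ b}))
    (Φs : (Fin n → ℝ≥0) → ℝ≥0)
    (hΦs : ∀ y, Φs y = sSup (Φ '' {x ∈ A | x ≤ y})) :
    (Φs 0 = 0 ∧ ∀ y : Fin n → ℝ≥0, y ≠ 0 → 0 < Φs y) ↔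
      ∀ (j₀ : Fin n) (ε : ℝ≥0), 0 < ε →
        ∃ t : ℝ≥0, 0 < t ∧ t ≤ ε ∧ (fun i => if i = j₀ then t else 0) ∈ A := by
  have hne : ∀ y : Fin n → ℝ≥0, (Φ '' {x ∈ A | x ≤ y}).Nonempty := by
    intro y
    exact ⟨Φ 0, 0, ⟨h0A, fun i => zero_le⟩, rfl⟩
  constructor
  · rintro ⟨-, hpos⟩ j ε hε
    have hy : (fun i => if i = j then ε else 0 : Fin n → ℝ≥0) ≠ 0 := by
      intro h
      have := congrFun h j
      simp at this
      exact hε.ne' this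
    have h1 := hpos _ hy
    rw [hΦs] at h1
    obtain ⟨_, ⟨x, ⟨hxA, hxy⟩, rfl⟩, hx⟩ :=
      exists_lt_of_lt_csSup (hne _) h1
    have hxe : x = fun i => if i = j then x j else 0 := by
      funext i
      by_cases hi : i = j
      · simp [hi]
      · have := hxy i
        simp [hi] at this
        simp [hi, this]
    refine ⟨x j, ?_, ?_, hxe ▸ hxA⟩
    · rw [pos_iff_ne_zero]
      intro h
      have hx0 : x = 0 := by
        rw [hxe, h]
        funext i
        simp
      rw [hx0, hamen.1] at hx
      exact lt_irrefl _ hx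
    · have := hxy j
      simpa using this
  · intro H
    refine ⟨?_, ?_⟩
    · rw [hΦs]
      have hle : sSup (Φ '' {x ∈ A | x ≤ 0}) ≤ 0 := by
        apply csSup_le (hne 0)
        rintro _ ⟨x, ⟨_, hx⟩, rfl⟩
        have hx0 : x = 0 := le_antisymm hx (fun i => zero_le)
        rw [hx0, hamen.1]
      exact le_antisymm hle zero_le
    · intro y hy
      obtain ⟨j, hj⟩ := Function.ne_iff.mp hy
      obtain ⟨t, ht, hty, htA⟩ := H j (y j) (pos_iff_ne_zero.mpr hj)
      rw [hΦs]
      refine lt_of_lt_of_le (hamen.2 _ htA ?_) (le_csSup (hbdd y) ⟨_, ⟨htA, ?_⟩, rfl⟩)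
      · intro h
        have := congrFun h j
        simp at this
        exact ht.ne' this
      · intro i
        by_cases hi : i = j
        · subst hi
          simpa using hty
        · simp [hi]
end

section
/- Let n be a positive integer, let A ⊆ ℝ₊ⁿ with 0̄ ∈ A, and let Φ : A → ℝ₊ be isotone and amenable. Then the following are equivalent: (i) there exists an isotone amenable function Ψ : ℝ₊ⁿ → ℝ₊ with Ψ|_A = Φ; (ii) sup{Φ(x) : x ∈ A, x ≤ b} < ∞ for every b ∈ ℝ₊ⁿ, and for every subset B ⊆ A with inf(Φ(B)) = 0 the equalities inf(pr_j(B)) = 0 hold for all j = 1,…,n, where pr_j denotes the j-th coordinate projection. -/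
open scoped NNReal

/-- Lemma 2.6. Let `A ⊆ ℝ₊ⁿ` contain `0̄` and let `Φ : A → ℝ₊` be isotone
and amenable. Then `Φ` has an isotone amenable continuation `Ψ : ℝ₊ⁿ → ℝ₊` iff
`sup {Φ x : x ∈ A, x ≤ b} < ∞` for every `b ∈ ℝ₊ⁿ` and for every `B ⊆ A` with
`inf (Φ(B)) = 0` one has `inf (pr_j(B)) = 0` for every coordinate `j`. -/
theorem stmt_2 (n : ℕ) (hn : 0 < n) (A : Set (Fin n → ℝ≥0))
    (h0A : (0 : Fin n → ℝ≥0) ∈ A)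
    (Φ : (Fin n → ℝ≥0) → ℝ≥0) (hΦ : MonotoneOn Φ A)
    (hamen : Φ 0 = 0 ∧ ∀ x ∈ A, x ≠ 0 → 0 < Φ x) :
    (∃ Ψ : (Fin n → ℝ≥0) → ℝ≥0, Monotone Ψ ∧
        (Ψ 0 = 0 ∧ ∀ y : Fin n → ℝ≥0, y ≠ 0 → 0 < Ψ y) ∧
        ∀ x ∈ A, Ψ x = Φ x) ↔
      ((∀ b : Fin n → ℝ≥0, BddAbove (Φ '' {x ∈ A | x ≤ b})) ∧
        ∀ B ⊆ A, sInf (Φ '' B) = 0 → ∀ j : Fin n, sInf ((fun x => x j) '' B) = 0) := by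
  constructor
  · rintro ⟨Ψ, hmono, ⟨hΨ0, hpos⟩, hext⟩
    refine ⟨fun b => ⟨Ψ b, ?_⟩, ?_⟩
    · rintro _ ⟨x, ⟨hxA, hxb⟩, rfl⟩
      rw [← hext x hxA]
      exact hmono hxb
    · intro B hBA hB j
      rcases B.eq_empty_or_nonempty with rfl | hne
      · simp
      by_contra hc
      have hcpos : 0 < sInf ((fun x : Fin n → ℝ≥0 => x j) '' B) := pos_iff_ne_zero.mpr hc
      set c := sInf ((fun x : Fin n → ℝ≥0 => x j) '' B) with hcdef
      have hs : (Pi.single j c : Fin n → ℝ≥0) ≠ 0 := by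
        intro h
        have h1 := congrFun h j
        simp only [Pi.single_eq_same, Pi.zero_apply] at h1
        exact hc h1
      have h2 : Ψ (Pi.single j c) ≤ sInf (Φ '' B) := by
        apply le_csInf (hne.image _)
        rintro _ ⟨x, hx, rfl⟩
        rw [← hext x (hBA hx)]
        apply hmono
        intro i
        by_cases hij : i = j
        · subst hij
          rw [Pi.single_eq_same]
          exact csInf_le (OrderBot.bddBelow _) ⟨x, hx, rfl⟩
        · rw [Pi.single_eq_of_ne hij]
          exact zero_le
      rw [hB] at h2
      exact absurd (hpos _ hs) (not_lt.mpr h2)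
  · rintro ⟨hbdd, hinf⟩
    let S : (Fin n → ℝ≥0) → ℝ≥0 := fun y => sSup (Φ '' {x ∈ A | x ≤ y})
    let g : (Fin n → ℝ≥0) → ℝ≥0 := fun y => sInf (insert 1 (Φ '' {x ∈ A | y ≤ x}))
    have hSA : ∀ x ∈ A, S x = Φ x := by
      intro x hx
      apply le_antisymm
      · refine csSup_le ⟨Φ x, x, ⟨hx, le_rfl⟩, rfl⟩ ?_
        rintro _ ⟨z, ⟨hz, hzx⟩, rfl⟩
        exact hΦ hz hx hzx
      · exact le_csSup (hbdd x) ⟨x, ⟨hx, le_rfl⟩, rfl⟩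
    have hgA : ∀ x ∈ A, g x ≤ Φ x := fun x hx =>
      csInf_le (OrderBot.bddBelow _) (Or.inr ⟨x, ⟨hx, le_rfl⟩, rfl⟩)
    have hA : ∀ x ∈ A, max (S x) (g x) = Φ x := fun x hx => by
      rw [hSA x hx]
      exact max_eq_left (hgA x hx)
    refine ⟨fun y => max (S y) (g y), ?_, ⟨?_, ?_⟩, hA⟩
    · intro a b hab
      apply max_le_max
      · refine csSup_le_csSup (hbdd b) ⟨Φ 0, 0, ⟨h0A, fun _ => zero_le⟩, rfl⟩ ?_
        rintro _ ⟨z, ⟨hz, hza⟩, rfl⟩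
        exact ⟨z, ⟨hz, hza.trans hab⟩, rfl⟩
      · apply csInf_le_csInf (OrderBot.bddBelow _) (Set.insert_nonempty _ _)
        apply Set.insert_subset_insert
        rintro _ ⟨z, ⟨hz, hza⟩, rfl⟩
        exact ⟨z, ⟨hz, hab.trans hza⟩, rfl⟩
    · exact (hA 0 h0A).trans hamen.1
    · intro y hy
      apply lt_max_of_lt_right
      obtain ⟨j, hj⟩ := Function.ne_iff.mp hy
      have hjp : 0 < y j := pos_iff_ne_zero.mpr hj
      rcases Set.eq_empty_or_nonempty {x ∈ A | y ≤ x} with he | hne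
      · simp only [g, he, Set.image_empty]
        simp
      · have hc : sInf (Φ '' {x ∈ A | y ≤ x}) ≠ 0 := by
          intro h
          have h1 := hinf _ (fun x hx => hx.1) h j
          have h2 : y j ≤ sInf ((fun x : Fin n → ℝ≥0 => x j) '' {x ∈ A | y ≤ x}) := by
            apply le_csInf (hne.image _)
            rintro _ ⟨x, hx, rfl⟩
            exact hx.2 j
          rw [h1] at h2
          exact absurd hjp (not_lt.mpr h2)
        refine lt_of_lt_of_le (lt_min one_pos (pos_iff_ne_zero.mpr hc)) ?_
        apply le_csInf (Set.insert_nonempty _ _)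
        rintro _ (rfl | hz)
        · exact min_le_left _ _
        · exact (min_le_right _ _).trans (csInf_le (OrderBot.bddBelow _) hz)
end

section
/- Let n be a positive integer and let A be a nonempty subset of ℝ₊ⁿ. For a function Φ : A → ℝ₊ the following are equivalent: (i) Φ is isotone and subadditive (meaning: for every integer m ≥ 2 and all x, x¹,…,xᵐ ∈ A, if x ≤ x¹ + ⋯ + xᵐ then Φ(x) ≤ Φ(x¹) + ⋯ + Φ(xᵐ), and Φ is isotone); (ii) there exists an isotone subadditive function Ψ : ℝ₊ⁿ → ℝ₊ such that Ψ|_A = Φ. -/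
open scoped NNReal

/-- Subadditivity in the sense of Definition 2.7: for every integer `m ≥ 2` and all
`x, x¹, …, xᵐ ∈ A`, if `x ≤ x¹ + ⋯ + xᵐ` then `Φ x ≤ Φ x¹ + ⋯ + Φ xᵐ`. -/
def SubadditiveOnSet (n : ℕ) (A : Set (Fin n → ℝ≥0)) (Φ : (Fin n → ℝ≥0) → ℝ≥0) : Prop :=
  ∀ (m : ℕ), 2 ≤ m → ∀ x ∈ A, ∀ xs : Fin m → Fin n → ℝ≥0,
    (∀ i, xs i ∈ A) → x ≤ ∑ i, xs i → Φ x ≤ ∑ i, Φ (xs i)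

/-- Lists of elements of `A` whose sum dominates `x` on the support of `A`. -/
def Cov (n : ℕ) (A : Set (Fin n → ℝ≥0)) (x : Fin n → ℝ≥0) (l : List (Fin n → ℝ≥0)) : Prop :=
  l ≠ [] ∧ (∀ a ∈ l, a ∈ A) ∧ ∀ i, (∃ a ∈ A, a i ≠ 0) → x i ≤ l.sum i

lemma cov_exists (n : ℕ) (A : Set (Fin n → ℝ≥0)) (hA : A.Nonempty) (x : Fin n → ℝ≥0) :
    ∃ l, Cov n A x l := by
  have key : ∀ F : Finset (Fin n), ∃ l : List (Fin n → ℝ≥0), l ≠ [] ∧ (∀ a ∈ l, a ∈ A) ∧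
      ∀ i ∈ F, (∃ a ∈ A, a i ≠ 0) → x i ≤ l.sum i := by
    intro F
    induction F using Finset.induction_on with
    | empty =>
      obtain ⟨a, ha⟩ := hA
      exact ⟨[a], by simp, by simpa using ha, by simp⟩
    | insert j F hj ih =>
      obtain ⟨l, h1, h2, h3⟩ := ih
      by_cases hS : ∃ a ∈ A, a j ≠ 0
      · obtain ⟨a, ha, haj⟩ := hS
        obtain ⟨k, hk⟩ := exists_nat_ge (x j / a j)
        have hk' : x j ≤ k * a j := by
          rwa [div_le_iff₀ (pos_iff_ne_zero.mpr haj)] at hk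
        refine ⟨l ++ List.replicate k a, by simp [h1], ?_, ?_⟩
        · intro b hb
          rcases List.mem_append.mp hb with hb | hb
          · exact h2 b hb
          · rw [List.eq_of_mem_replicate hb]; exact ha
        · intro i hi hSi
          rw [List.sum_append, List.sum_replicate, Pi.add_apply, Pi.smul_apply, nsmul_eq_mul]
          rcases Finset.mem_insert.mp hi with rfl | hi
          · exact hk'.trans le_add_self
          · exact (h3 i hi hSi).trans le_self_add
      · refine ⟨l, h1, h2, ?_⟩
        intro i hi hSi
        rcases Finset.mem_insert.mp hi with rfl | hi
        · exact absurd hSi hS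
        · exact h3 i hi hSi
  obtain ⟨l, h1, h2, h3⟩ := key Finset.univ
  exact ⟨l, h1, h2, fun i => h3 i (Finset.mem_univ i)⟩

lemma cov_le (n : ℕ) (A : Set (Fin n → ℝ≥0)) (Φ : (Fin n → ℝ≥0) → ℝ≥0)
    (hm : MonotoneOn Φ A) (hs : SubadditiveOnSet n A Φ) (x : Fin n → ℝ≥0) (hx : x ∈ A)
    (l : List (Fin n → ℝ≥0)) (hl : Cov n A x l) : Φ x ≤ (l.map Φ).sum := by
  obtain ⟨h1, h2, h3⟩ := hl
  have hle : x ≤ l.sum := by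
    intro i
    by_cases h : x i = 0
    · rw [h]; exact zero_le
    · exact h3 i ⟨x, hx, h⟩
  match l, h1, h2, hle with
  | [a], _, h2, hle => simpa using hm hx (h2 a (by simp)) (by simpa using hle)
  | a :: b :: t, _, h2, hle =>
    have := hs (a :: b :: t).length (by simp) x hx (fun i => (a :: b :: t).get i)
      (fun i => h2 _ (List.get_mem _ _))
      (by rw [← List.sum_ofFn, List.ofFn_get]; exact hle)
    rw [← List.sum_ofFn] at this
    have e : List.ofFn (fun i => Φ ((a :: b :: t).get i)) = (a :: b :: t).map Φ := by
      conv_rhs => rw [← List.ofFn_get (a :: b :: t), List.map_ofFn]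
      rfl
    rwa [e] at this

/-- Lemma 2.9. Let `A` be a nonempty subset of `ℝ₊ⁿ`. A function
`Φ : A → ℝ₊` is isotone and subadditive (Definition 2.7) iff there exists an isotone
subadditive `Ψ : ℝ₊ⁿ → ℝ₊` with `Ψ|_A = Φ`. -/
theorem stmt_3 (n : ℕ) (hn : 0 < n) (A : Set (Fin n → ℝ≥0)) (hA : A.Nonempty)
    (Φ : (Fin n → ℝ≥0) → ℝ≥0) :
    (MonotoneOn Φ A ∧ SubadditiveOnSet n A Φ) ↔
      ∃ Ψ : (Fin n → ℝ≥0) → ℝ≥0, Monotone Ψ ∧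
        (∀ x y : Fin n → ℝ≥0, Ψ (x + y) ≤ Ψ x + Ψ y) ∧ ∀ x ∈ A, Ψ x = Φ x := by
  constructor
  · rintro ⟨hm, hs⟩
    let T : (Fin n → ℝ≥0) → Set ℝ≥0 := fun x => {r | ∃ l, Cov n A x l ∧ (l.map Φ).sum = r}
    have hT : ∀ x, (T x).Nonempty := fun x => by
      obtain ⟨l, hl⟩ := cov_exists n A hA x
      exact ⟨_, l, hl, rfl⟩
    refine ⟨fun x => sInf (T x), ?_, ?_, ?_⟩
    · intro x y hxy
      refine csInf_le_csInf (OrderBot.bddBelow _) (hT y) ?_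
      rintro r ⟨l, ⟨h1, h2, h3⟩, rfl⟩
      exact ⟨l, ⟨h1, h2, fun i hi => (hxy i).trans (h3 i hi)⟩, rfl⟩
    · intro x y
      have key : ∀ a ∈ T x, ∀ b ∈ T y, sInf (T (x + y)) ≤ a + b := by
        rintro _ ⟨l, ⟨h1, h2, h3⟩, rfl⟩ _ ⟨l', ⟨h1', h2', h3'⟩, rfl⟩
        refine csInf_le (OrderBot.bddBelow _) ⟨l ++ l', ⟨by simp [h1], ?_, ?_⟩, by simp⟩
        · intro b hb
          rcases List.mem_append.mp hb with hb | hb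
          · exact h2 b hb
          · exact h2' b hb
        · intro i hi
          rw [List.sum_append]
          exact add_le_add (h3 i hi) (h3' i hi)
      change sInf (T (x + y)) ≤ sInf (T x) + sInf (T y)
      rw [← tsub_le_iff_left]
      refine le_csInf (hT y) fun b hb => ?_
      rw [tsub_le_iff_left, ← tsub_le_iff_right]
      refine le_csInf (hT x) fun a ha => ?_
      rw [tsub_le_iff_right]
      exact key a ha b hb
    · intro x hx
      apply le_antisymm
      · exact csInf_le (OrderBot.bddBelow _)
          ⟨[x], ⟨by simp, by simpa using hx, by simp⟩, by simp⟩
      · refine le_csInf (hT x) ?_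
        rintro _ ⟨l, hl, rfl⟩
        exact cov_le n A Φ hm hs x hx l hl
  · rintro ⟨Ψ, hm, hs, he⟩
    refine ⟨fun x hx y hy hxy => ?_, ?_⟩
    · rw [← he x hx, ← he y hy]; exact hm hxy
    · intro m hm2 x hx xs hxs hle
      rw [← he x hx, Finset.sum_congr rfl fun i _ => (he _ (hxs i)).symm]
      refine (hm hle).trans ?_
      have : Nonempty (Fin m) := ⟨⟨0, by omega⟩⟩
      exact Finset.le_sum_nonempty_of_subadditive Ψ hs Finset.univ_nonempty xs
end

section
/- Let n be a positive integer and let A ⊆ ℝ₊ⁿ be such that for every j ∈ {1,…,n} there is a ∈ A with pr_j(a) > 0. Let Φ : A → ℝ₊ be arbitrary and define Ψ : ℝ₊ⁿ → ℝ₊ by Ψ(x) = inf{ Φ(x¹) + ⋯ + Φ(xᵏ) : k ≥ 1, x¹,…,xᵏ ∈ A, x ≤ x¹ + ⋯ + xᵏ }. Then: (i) Ψ is isotone and subadditive; (ii) Φ(x) ≥ Ψ(x) for every x ∈ A; (iii) Φ = Ψ|_A if and only if Φ is isotone and subadditive (in the sense of Definition 2.7); (iv) if F : ℝ₊ⁿ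 → ℝ₊ is an isotone subadditive function with Φ(x) ≥ F(x) for every x ∈ A, then Ψ(x) ≥ F(x) for every x ∈ ℝ₊ⁿ. -/
open scoped NNReal

/-- The function `Ψ` of formula (2.20):
`Ψ x = inf { Φ x¹ + ⋯ + Φ xᵏ : k ≥ 1, x¹,…,xᵏ ∈ A, x ≤ x¹ + ⋯ + xᵏ }`. -/
noncomputable def psiInf (n : ℕ) (A : Set (Fin n → ℝ≥0)) (Φ : (Fin n → ℝ≥0) → ℝ≥0)
    (x : Fin n → ℝ≥0) : ℝ≥0 :=
  sInf {s : ℝ≥0 | ∃ k : ℕ, 1 ≤ k ∧ ∃ xs : Fin k → Fin n → ℝ≥0,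
    (∀ i, xs i ∈ A) ∧ x ≤ ∑ i, xs i ∧ s = ∑ i, Φ (xs i)}

/-- The set over which the infimum defining `psiInf` is taken. -/
def psiSet (n : ℕ) (A : Set (Fin n → ℝ≥0)) (Φ : (Fin n → ℝ≥0) → ℝ≥0)
    (x : Fin n → ℝ≥0) : Set ℝ≥0 :=
  {s : ℝ≥0 | ∃ k : ℕ, 1 ≤ k ∧ ∃ xs : Fin k → Fin n → ℝ≥0,
    (∀ i, xs i ∈ A) ∧ x ≤ ∑ i, xs i ∧ s = ∑ i, Φ (xs i)}

theorem psiSet_mem {n : ℕ} {A : Set (Fin n → ℝ≥0)} {Φ : (Fin n → ℝ≥0) → ℝ≥0}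
    {x : Fin n → ℝ≥0} {ι : Type} [Fintype ι] [Nonempty ι] (xs : ι → Fin n → ℝ≥0)
    (h : ∀ i, xs i ∈ A) (hx : x ≤ ∑ i, xs i) : ∑ i, Φ (xs i) ∈ psiSet n A Φ x := by
  let e := (Fintype.equivFin ι).symm
  refine ⟨Fintype.card ι, Fintype.card_pos, fun i => xs (e i), fun i => h _, ?_, ?_⟩
  · rwa [Equiv.sum_comp e xs]
  · exact (Equiv.sum_comp e (fun i => Φ (xs i))).symm

theorem psi_le {n : ℕ} {A : Set (Fin n → ℝ≥0)} {Φ : (Fin n → ℝ≥0) → ℝ≥0}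
    {x : Fin n → ℝ≥0} {s : ℝ≥0} (h : s ∈ psiSet n A Φ x) : psiInf n A Φ x ≤ s :=
  csInf_le (OrderBot.bddBelow _) h

theorem psiSet_nonempty {n : ℕ} (hn : 0 < n) {A : Set (Fin n → ℝ≥0)}
    (hA : ∀ j : Fin n, ∃ a ∈ A, 0 < a j) (Φ : (Fin n → ℝ≥0) → ℝ≥0)
    (x : Fin n → ℝ≥0) : (psiSet n A Φ x).Nonempty := by
  choose a ha hpos using hA
  have h1 : ∀ j, ∃ N : ℕ, x j ≤ N • a j j := fun j => Archimedean.arch _ (hpos j)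
  choose N hN using h1
  haveI : Nonempty (Fin n) := ⟨⟨0, hn⟩⟩
  haveI : Nonempty (Fin n × Fin (∑ j, N j + 1)) := inferInstance
  refine ⟨_, psiSet_mem (ι := Fin n × Fin (∑ j, N j + 1)) (fun p => a p.1)
    (fun p => ha _) ?_⟩
  intro j
  rw [Fintype.sum_prod_type, Finset.sum_apply]
  simp only [Finset.sum_const, Finset.card_univ, Fintype.card_fin, Pi.smul_apply]
  refine (hN j).trans (le_trans ?_ (Finset.single_le_sum
    (f := fun i => (∑ j, N j + 1) • a i j) (fun i _ => zero_le) (Finset.mem_univ j)))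
  refine nsmul_le_nsmul_left zero_le ?_
  have := Finset.single_le_sum (f := N) (fun i _ => Nat.zero_le _) (Finset.mem_univ j)
  omega

/-- Theorem 2.10. Suppose that for every coordinate `j` there is `a ∈ A`
with `pr_j a > 0`, and let `Φ : A → ℝ₊` be arbitrary. Then the function `Ψ` of (2.20):
(i) is isotone and subadditive; (ii) satisfies `Ψ ≤ Φ` on `A`; (iii) coincides with `Φ` on
`A` iff `Φ` is isotone and subadditive (Definition 2.7); (iv) dominates every isotone
subadditive `F : ℝ₊ⁿ → ℝ₊` with `F ≤ Φ` on `A`. -/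
theorem stmt_4 (n : ℕ) (hn : 0 < n) (A : Set (Fin n → ℝ≥0))
    (hA : ∀ j : Fin n, ∃ a ∈ A, 0 < a j) (Φ : (Fin n → ℝ≥0) → ℝ≥0) :
    (Monotone (psiInf n A Φ) ∧
        ∀ x y : Fin n → ℝ≥0, psiInf n A Φ (x + y) ≤ psiInf n A Φ x + psiInf n A Φ y) ∧
      (∀ x ∈ A, psiInf n A Φ x ≤ Φ x) ∧
      ((∀ x ∈ A, psiInf n A Φ x = Φ x) ↔ (MonotoneOn Φ A ∧ SubadditiveOnSet n A Φ)) ∧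
      (∀ F : (Fin n → ℝ≥0) → ℝ≥0, Monotone F →
        (∀ x y : Fin n → ℝ≥0, F (x + y) ≤ F x + F y) →
        (∀ x ∈ A, F x ≤ Φ x) → ∀ x : Fin n → ℝ≥0, F x ≤ psiInf n A Φ x) := by
  have hne := psiSet_nonempty hn hA Φ
  have hmono : Monotone (psiInf n A Φ) := by
    intro x y hxy
    refine le_csInf (hne y) ?_
    rintro s ⟨k, hk, xs, h1, h2, rfl⟩
    exact psi_le ⟨k, hk, xs, h1, hxy.trans h2, rfl⟩
  have hle : ∀ x ∈ A, psiInf n A Φ x ≤ Φ x := by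
    intro x hx
    exact psi_le ⟨1, le_rfl, fun _ => x, fun _ => hx, by simp, by simp⟩
  refine ⟨⟨hmono, ?_⟩, hle, ⟨?_, ?_⟩, ?_⟩
  · intro x y
    refine le_of_forall_pos_le_add fun ε hε => ?_
    have hε2 : 0 < ε / 2 := half_pos hε
    obtain ⟨s, ⟨k, hk, xs, h1, h2, rfl⟩, hs⟩ :=
      exists_lt_of_csInf_lt (hne x) (lt_add_of_pos_right (psiInf n A Φ x) hε2)
    obtain ⟨t, ⟨l, hl, ys, g1, g2, rfl⟩, ht⟩ :=
      exists_lt_of_csInf_lt (hne y) (lt_add_of_pos_right (psiInf n A Φ y) hε2)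
    haveI : Nonempty (Fin k ⊕ Fin l) := ⟨Sum.inl ⟨0, hk⟩⟩
    have key := psi_le (psiSet_mem (A := A) (Φ := Φ) (x := x + y) (Sum.elim xs ys)
      (by rintro (i | i); exacts [h1 i, g1 i])
      (by simpa [Fintype.sum_sum_type] using add_le_add h2 g2))
    simp only [Fintype.sum_sum_type, Sum.elim_inl, Sum.elim_inr] at key
    refine key.trans ((add_le_add hs.le ht.le).trans (le_of_eq ?_))
    rw [add_add_add_comm, add_halves]
  · intro h
    refine ⟨fun x hx y hy hxy => ?_, fun m hm x hx xs h1 h2 => ?_⟩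
    · rw [← h x hx, ← h y hy]
      exact hmono hxy
    · rw [← h x hx]
      exact psi_le ⟨m, by omega, xs, h1, h2, rfl⟩
  · rintro ⟨hm, hsub⟩ x hx
    refine le_antisymm (hle x hx) (le_csInf (hne x) ?_)
    rintro s ⟨k, hk, xs, h1, h2, rfl⟩
    rcases Nat.lt_or_ge 1 k with h | h
    · exact hsub k h x hx xs h1 h2
    · obtain rfl : k = 1 := le_antisymm h hk
      rw [Fin.sum_univ_one] at h2 ⊢
      exact hm hx (h1 0) h2
  · intro F hF hadd hFΦ x
    refine le_csInf (hne x) ?_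
    rintro s ⟨k, hk, xs, h1, h2, rfl⟩
    refine (hF h2).trans (le_trans ?_ (Finset.sum_le_sum fun i _ => hFΦ _ (h1 i)))
    exact Finset.le_sum_nonempty_of_subadditive F hadd ⟨⟨0, hk⟩, Finset.mem_univ _⟩ xs
end

section
/- Let n be a positive integer and let f : ℝ₊ⁿ → ℝ₊ be an isotone function. Then f is a metric preserving function of n variables if and only if f is subadditive and amenable. -/
open scoped NNReal

/-- `d` is a metric on `α`: nonnegative, vanishing exactly on the diagonal, symmetric and
satisfying the triangle inequality. -/
def IsMetric {α : Type*} (d : α → α → ℝ) : Prop :=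
  (∀ x y, 0 ≤ d x y) ∧ (∀ x y, d x y = 0 ↔ x = y) ∧ (∀ x y, d x y = d y x) ∧
    ∀ x y z, d x z ≤ d x y + d y z

/-- `Φ : ℝ₊ⁿ → ℝ₊` is a metric preserving function of `n` variables: for every collection
of metric spaces `(X₁,d₁),…,(Xₙ,dₙ)`, the function
`((x₁,…,xₙ),(y₁,…,yₙ)) ↦ Φ (d₁ x₁ y₁, …, dₙ xₙ yₙ)` is a metric on `X₁ × ⋯ × Xₙ`. -/
def MetricPreserving (n : ℕ) (Φ : (Fin n → ℝ≥0) → ℝ≥0) : Prop :=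
  ∀ (X : Fin n → Type*) [∀ i, MetricSpace (X i)],
    IsMetric (fun x y : ∀ i, X i => ((Φ fun i => nndist (x i) (y i) : ℝ≥0) : ℝ))

universe w

lemma key {n : ℕ} (x : Fin n → ℝ≥0) :
    (fun i => nndist (ULift.up.{w} ((x i : ℝ))) (ULift.up.{w} (0 : ℝ))) = x := by
  funext i
  apply NNReal.eq
  rw [coe_nndist, ULift.dist_up_up]
  simp

lemma key2 {n : ℕ} (x y : Fin n → ℝ≥0) :
    (fun i => nndist (ULift.up.{w} (((x + y) i : ℝ≥0) : ℝ)) (ULift.up.{w} ((y i : ℝ)))) = x := by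
  funext i
  apply NNReal.eq
  rw [coe_nndist, ULift.dist_up_up]
  simp

/-- Theorem 3.1. An isotone function `f : ℝ₊ⁿ → ℝ₊` is metric preserving
iff it is subadditive and amenable. -/
theorem stmt_5 (n : ℕ) (hn : 0 < n) (f : (Fin n → ℝ≥0) → ℝ≥0) (hf : Monotone f) :
    MetricPreserving n f ↔
      ((∀ x y : Fin n → ℝ≥0, f (x + y) ≤ f x + f y) ∧
        (f 0 = 0 ∧ ∀ x : Fin n → ℝ≥0, x ≠ 0 → 0 < f x)) := by
  constructor
  · intro h
    have H := h (fun _ => ULift ℝ)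
    obtain ⟨-, h0, -, ht⟩ := H
    refine ⟨fun x y => ?_, ?_, fun x hx => ?_⟩
    · have := ht (fun i => ULift.up (((x + y) i : ℝ≥0) : ℝ)) (fun i => ULift.up (y i : ℝ))
        (fun i => ULift.up (0 : ℝ))
      beta_reduce at this
      rw [key, key, key2] at this
      exact_mod_cast this
    · have := (h0 (fun i => ULift.up (((0 : Fin n → ℝ≥0) i : ℝ≥0) : ℝ)) (fun i => ULift.up (0 : ℝ))).2
        (by funext i; simp)
      beta_reduce at this
      rw [key] at this
      exact_mod_cast this
    · rw [pos_iff_ne_zero]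
      intro hfx
      apply hx
      have := (h0 (fun i => ULift.up (x i : ℝ)) (fun i => ULift.up (0 : ℝ))).1
        (by beta_reduce; rw [key]; exact_mod_cast hfx)
      funext i
      have h2 := congrArg ULift.down (congrFun this i)
      exact NNReal.eq h2
  · rintro ⟨hs, h0, hp⟩ X _
    refine ⟨fun x y => NNReal.coe_nonneg _, fun x y => ?_, fun x y => ?_, fun x y z => ?_⟩
    · constructor
      · intro h
        by_contra hne
        have h' : f (fun i => nndist (x i) (y i)) = 0 := NNReal.eq h
        refine (hp (fun i => nndist (x i) (y i)) ?_).ne' h'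
        intro h3
        exact hne (funext fun i => nndist_eq_zero.1 (congrFun h3 i))
      · rintro rfl
        have : (fun i => nndist (x i) (x i)) = 0 := by funext i; simp
        simp only [this, h0, NNReal.coe_zero]
    · simp only [nndist_comm]
    · have h1 : f (fun i => nndist (x i) (z i)) ≤
          f (fun i => nndist (x i) (y i)) + f (fun i => nndist (y i) (z i)) :=
        (hf (fun i => nndist_triangle (x i) (y i) (z i))).trans (hs _ _)
      exact_mod_cast h1
end

section
/- Let (X₁,d_{X₁}),…,(Xₙ,d_{Xₙ}) be nonempty metric spaces and let d be a metric on P = X₁ × ⋯ × Xₙ. Then the following are equivalent: (i) d is an isotone metric product, i.e., there exists an isotone function Φ : D_{X₁} × ⋯ × D_{Xₙ} → ℝ₊ such that d((x₁,…,xₙ),(y₁,…,yₙ)) = Φ(d_{X₁}(x₁,y₁),…,d_{Xₙ}(xₙ,yₙ)) for all points of P; (ii) d is distance-increasing, i.e., d((x₁,…,xₙ),(y₁,…,yₙ)) ≤ d((x̃₁,…,x̃ₙ),(ỹ₁,…,ỹₙ)) whenever d_{Xᵢ}(xᵢ,yᵢ) ≤ d_{Xᵢ}(x̃ᵢ,ỹᵢ)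 for every i ∈ {1,…,n}. -/
open scoped NNReal

/-- Lemma 3.3. For nonempty metric spaces `X₁,…,Xₙ` and a metric `d` on
`P = X₁ × ⋯ × Xₙ`, `d` is an isotone metric product (i.e. `d = Φ(d₁,…,dₙ)` for some
function `Φ` isotone on the product of the distance sets) iff `d` is distance-increasing. -/
theorem stmt_6 (n : ℕ) (hn : 0 < n) (X : Fin n → Type*) [∀ i, MetricSpace (X i)]
    [∀ i, Nonempty (X i)]
    (d : (∀ i, X i) → (∀ i, X i) → ℝ) (hd : IsMetric d) :
    (∃ Φ : (Fin n → ℝ≥0) → ℝ≥0,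
        MonotoneOn Φ {v : Fin n → ℝ≥0 | ∀ i, ∃ a b : X i, nndist a b = v i} ∧
        ∀ x y : ∀ i, X i, d x y = Φ fun i => nndist (x i) (y i)) ↔
      ∀ x y x' y' : ∀ i, X i,
        (∀ i, dist (x i) (y i) ≤ dist (x' i) (y' i)) → d x y ≤ d x' y' := by
  classical
  constructor
  · rintro ⟨Φ, hΦ, hE⟩ x y x' y' h
    rw [hE, hE]
    exact NNReal.coe_le_coe.2 (hΦ (fun i => ⟨_, _, rfl⟩) (fun i => ⟨_, _, rfl⟩) fun i => h i)
  · intro H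
    let Q : (Fin n → ℝ≥0) → (∀ i, X i) × (∀ i, X i) → Prop :=
      fun v p => ∀ i, nndist (p.1 i) (p.2 i) = v i
    have key : ∀ v, ∃ r : ℝ≥0, ∀ p, Q v p → d p.1 p.2 = r := by
      intro v
      by_cases hv : ∃ p, Q v p
      · obtain ⟨p, hp⟩ := hv
        refine ⟨⟨d p.1 p.2, hd.1 _ _⟩, fun q hq => ?_⟩
        have e : ∀ i, dist (q.1 i) (q.2 i) = dist (p.1 i) (p.2 i) := fun i => by
          rw [← coe_nndist, ← coe_nndist, hp i, hq i]
        exact le_antisymm (H _ _ _ _ fun i => (e i).le) (H _ _ _ _ fun i => (e i).ge)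
      · exact ⟨0, fun p hp => (hv ⟨p, hp⟩).elim⟩
    choose Φ hΦ using key
    refine ⟨Φ, ?_, fun x y => hΦ _ (x, y) fun i => rfl⟩
    intro v hv w hw hvw
    choose a b hab using hv
    choose a' b' hab' using hw
    rw [← NNReal.coe_le_coe, ← hΦ v (a, b) hab, ← hΦ w (a', b') hab']
    refine H _ _ _ _ fun i => ?_
    have h := hvw i
    rw [← hab i, ← hab' i] at h
    exact h
end

section
/- Let (X₁,d_{X₁}),…,(Xₙ,d_{Xₙ}) be metric spaces and let d be a metric on P = X₁ × ⋯ × Xₙ. Then the following are equivalent: (i) d is an isotone metric product and there exists an isotone function Ψ : ℝ₊ⁿ → ℝ₊ with d((x₁,…,xₙ),(y₁,…,yₙ)) = Ψ(d_{X₁}(x₁,y₁),…,d_{Xₙ}(xₙ,yₙ)) for all points of P (an isotone continuation); (ii) d is distance-increasing and the identity map of P is bornologous as a map from (P,ρ∞) to (P,d), where ρ∞((x₁,…,xₙ),(y₁,…,yₙ)) = max_{1 ≤ i ≤ n} d_{Xᵢ}(xᵢ,yᵢ). -/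
open scoped NNReal

/-- Theorem 3.5. For metric spaces `X₁,…,Xₙ` and a metric `d` on
`P = X₁ × ⋯ × Xₙ`, the following are equivalent: (i) `d` is an isotone metric product
and has an isotone continuation `Ψ : ℝ₊ⁿ → ℝ₊`; (ii) `d` is distance-increasing and the
identity is bornologous from `(P,ρ∞)` to `(P,d)`, where `ρ∞` is the maximum metric. -/
theorem stmt_7 (n : ℕ) (hn : 0 < n) (X : Fin n → Type*) [∀ i, MetricSpace (X i)]
    (d : (∀ i, X i) → (∀ i, X i) → ℝ) (hd : IsMetric d) :
    ((∃ Φ : (Fin n → ℝ≥0) → ℝ≥0,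
        MonotoneOn Φ {v : Fin n → ℝ≥0 | ∀ i, ∃ a b : X i, nndist a b = v i} ∧
        ∀ x y : ∀ i, X i, d x y = Φ fun i => nndist (x i) (y i)) ∧
      (∃ Ψ : (Fin n → ℝ≥0) → ℝ≥0, Monotone Ψ ∧
        ∀ x y : ∀ i, X i, d x y = Ψ fun i => nndist (x i) (y i))) ↔
      ((∀ x y x' y' : ∀ i, X i,
          (∀ i, dist (x i) (y i) ≤ dist (x' i) (y' i)) → d x y ≤ d x' y') ∧
        ∀ ε : ℝ, 0 ≤ ε → ∃ δ : ℝ, 0 ≤ δ ∧ ∀ x y : ∀ i, X i,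
          ((Finset.univ.sup (fun i => nndist (x i) (y i)) : ℝ≥0) : ℝ) ≤ ε → d x y ≤ δ) := by
  constructor
  · rintro ⟨-, Ψ, hΨ, h⟩
    refine ⟨?_, ?_⟩
    · intro x y x' y' hxy
      rw [h, h]
      exact NNReal.coe_le_coe.2 (hΨ fun i => by
        rw [← NNReal.coe_le_coe]; simpa using hxy i)
    · intro ε hε
      refine ⟨Ψ fun _ => ⟨ε, hε⟩, NNReal.coe_nonneg _, ?_⟩
      intro x y hxy
      rw [h]
      refine NNReal.coe_le_coe.2 (hΨ fun i => ?_)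
      have h1 : nndist (x i) (y i) ≤ Finset.univ.sup (fun i => nndist (x i) (y i)) :=
        Finset.le_sup (f := fun i => nndist (x i) (y i)) (Finset.mem_univ i)
      exact h1.trans (NNReal.coe_le_coe.1 hxy)
  · rintro ⟨hmono, hb⟩
    have key : ∃ Ψ : (Fin n → ℝ≥0) → ℝ≥0, Monotone Ψ ∧
        ∀ x y : ∀ i, X i, d x y = Ψ fun i => nndist (x i) (y i) := by
      let S : (Fin n → ℝ≥0) → Set ℝ≥0 := fun v =>
        {r | ∃ x y : ∀ i, X i, (∀ i, nndist (x i) (y i) ≤ v i) ∧ d x y = r}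
      have hS : ∀ v, BddAbove (S v) := by
        intro v
        obtain ⟨δ, hδ, H⟩ := hb (Finset.univ.sup v : ℝ≥0) (NNReal.coe_nonneg _)
        refine ⟨⟨δ, hδ⟩, ?_⟩
        rintro r ⟨x, y, hxy, hr⟩
        refine NNReal.coe_le_coe.1 (hr.symm.le.trans ?_)
        exact H x y (NNReal.coe_le_coe.2 (Finset.sup_mono_fun fun i _ => hxy i))
      refine ⟨fun v => sSup (S v), ?_, ?_⟩
      · intro v w hvw
        rcases (S v).eq_empty_or_nonempty with he | hne
        · simp [he]
        · refine csSup_le_csSup (hS w) hne ?_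
          rintro r ⟨x, y, hxy, hr⟩
          exact ⟨x, y, fun i => (hxy i).trans (hvw i), hr⟩
      · intro x y
        have hg : IsGreatest (S fun i => nndist (x i) (y i)) ⟨d x y, hd.1 x y⟩ := by
          refine ⟨⟨x, y, fun i => le_rfl, rfl⟩, ?_⟩
          rintro r ⟨a, b, hab, hr⟩
          refine NNReal.coe_le_coe.1 (hr.symm.le.trans ?_)
          exact hmono a b x y fun i => by
            have := NNReal.coe_le_coe.2 (hab i)
            simpa using this
        show d x y = ((sSup (S fun i => nndist (x i) (y i)) : ℝ≥0) : ℝ)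
        rw [hg.csSup_eq]
        rfl
    obtain ⟨Ψ, h1, h2⟩ := key
    exact ⟨⟨Ψ, h1.monotoneOn _, h2⟩, ⟨Ψ, h1, h2⟩⟩
end

section
/- There exists a metric space (X,d) obtained as follows: X = [0,1), ρ(x,y) = max{x,y} for x ≠ y and ρ(x,x) = 0 (an ultrametric on X), and d = φ ∘ ρ where φ : [0,1) → (0,∞) is a continuous strictly decreasing-to-0-at-∞ type function with lim_{t→1} φ(t) = ∞ and lim_{t→0} φ(t) = 0 and φ strictly increasing; then d is an ultrametric on X, d is distance-increasing as a metric product over the single factor (X,ρ), the identity map from (X,ρ) to (X,d) is uniformly continuous but not bornologous, and consequently d has no isotone continuation, i.e., there is no isotone function Ψ : ℝ₊ → ℝ₊ with d(x,y) = Ψ(ρ(x,y)) for all x, y ∈ X. -/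
open scoped NNReal Classical

/-- The ultrametric `ρ` of Example 3.6 on `X = [0,1)`:
`ρ(x,y) = max{x,y}` for `x ≠ y` and `ρ(x,x) = 0`. -/
noncomputable def rhoEx (x y : Set.Ico (0 : ℝ) 1) : ℝ :=
  if x = y then 0 else max (x : ℝ) (y : ℝ)

lemma rho_nonneg (x y : Set.Ico (0 : ℝ) 1) : 0 ≤ rhoEx x y := by
  unfold rhoEx
  split_ifs
  · exact le_rfl
  · exact le_max_of_le_left x.2.1

lemma rho_lt (x y : Set.Ico (0 : ℝ) 1) : rhoEx x y < 1 := by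
  unfold rhoEx
  split_ifs
  · exact one_pos
  · exact max_lt x.2.2 y.2.2

lemma rho_eq (x y : Set.Ico (0 : ℝ) 1) : rhoEx x y = 0 ↔ x = y := by
  unfold rhoEx
  split_ifs with h
  · simp [h]
  · simp only [h, iff_false]
    intro h0
    apply h
    have h1 := le_max_left (x : ℝ) y
    have h2 := le_max_right (x : ℝ) y
    have h3 := x.2.1
    have h4 := y.2.1
    apply Subtype.ext
    linarith

lemma rho_comm (x y : Set.Ico (0 : ℝ) 1) : rhoEx x y = rhoEx y x := by
  unfold rhoEx
  by_cases h : x = y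
  · simp [h]
  · rw [if_neg h, if_neg (Ne.symm h), max_comm]

lemma rho_ultra (x y z : Set.Ico (0 : ℝ) 1) :
    rhoEx x z ≤ max (rhoEx x y) (rhoEx y z) := by
  by_cases h1 : x = y
  · subst h1
    exact le_max_right _ _
  by_cases h2 : y = z
  · subst h2
    exact le_max_left _ _
  by_cases h3 : x = z
  · rw [(rho_eq x z).2 h3]
    exact le_max_of_le_left (rho_nonneg _ _)
  unfold rhoEx
  rw [if_neg h1, if_neg h2, if_neg h3]
  exact max_le (le_max_of_le_left (le_max_left _ _)) (le_max_of_le_right (le_max_right _ _))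

lemma phi_strict : StrictMonoOn (fun t : ℝ => t / (1 - t)) (Set.Ico 0 1) := by
  intro a ha b hb hab
  have h1 : 0 < 1 - a := by linarith [ha.2]
  have h2 : 0 < 1 - b := by linarith [hb.2]
  show a / (1 - a) < b / (1 - b)
  rw [div_lt_div_iff₀ h1 h2]
  nlinarith

lemma phi_large (δ : ℝ) (hδ : 0 ≤ δ) : ∃ x y : Set.Ico (0 : ℝ) 1,
    δ < rhoEx x y / (1 - rhoEx x y) := by
  have hp : 0 < δ + 2 := by linarith
  have h0 : 0 < (δ + 1) / (δ + 2) := by positivity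
  have h1 : (δ + 1) / (δ + 2) < 1 := by
    rw [div_lt_one hp]
    linarith
  refine ⟨⟨0, le_rfl, one_pos⟩, ⟨(δ + 1) / (δ + 2), h0.le, h1⟩, ?_⟩
  have hr : rhoEx ⟨0, le_rfl, one_pos⟩ ⟨(δ + 1) / (δ + 2), h0.le, h1⟩
      = (δ + 1) / (δ + 2) := by
    unfold rhoEx
    rw [if_neg]
    · exact max_eq_right h0.le
    · intro h
      exact h0.ne (congrArg Subtype.val h)
  rw [hr, lt_div_iff₀ (by linarith)]
  have : 1 - (δ + 1) / (δ + 2) = 1 / (δ + 2) := by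
    field_simp
    ring
  rw [this, mul_one_div, div_lt_div_iff_of_pos_right hp]
  linarith

/-- Example 3.6. There is a continuous strictly increasing
`φ : [0,1) → ℝ₊` with `φ(t) → ∞` as `t → 1`, `φ(t) → 0` as `t → 0`, such that on
`X = [0,1)` with the ultrametric `ρ(x,y) = max{x,y}` (for `x ≠ y`), the function
`d = φ ∘ ρ` is again an ultrametric, `d` is distance-increasing over `(X,ρ)`, the identity
map is uniformly continuous from `(X,ρ)` to `(X,d)` but not bornologous, and consequently
`d` has no isotone continuation, i.e. there is no isotone `Ψ : ℝ₊ → ℝ₊` with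
`d(x,y) = Ψ(ρ(x,y))` for all `x, y ∈ X`. -/
theorem stmt_8 :
    ∃ φ : ℝ → ℝ,
      ContinuousOn φ (Set.Ico 0 1) ∧
      StrictMonoOn φ (Set.Ico 0 1) ∧
      φ 0 = 0 ∧
      (∀ t : ℝ, 0 < t → t < 1 → 0 < φ t) ∧
      Filter.Tendsto φ (nhdsWithin 1 (Set.Iio 1)) Filter.atTop ∧
      Filter.Tendsto φ (nhdsWithin 0 (Set.Ioi 0)) (nhds 0) ∧
      -- `ρ` is an ultrametric on `X = [0,1)`
      (IsMetric rhoEx ∧ ∀ x y z, rhoEx x z ≤ max (rhoEx x y) (rhoEx y z)) ∧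
      -- `d = φ ∘ ρ` is an ultrametric on `X`
      (IsMetric (fun x y => φ (rhoEx x y)) ∧
        ∀ x y z, φ (rhoEx x z) ≤ max (φ (rhoEx x y)) (φ (rhoEx y z))) ∧
      -- `d` is distance-increasing over the single factor `(X,ρ)`
      (∀ x y x' y', rhoEx x y ≤ rhoEx x' y' → φ (rhoEx x y) ≤ φ (rhoEx x' y')) ∧
      -- the identity is uniformly continuous from `(X,ρ)` to `(X,d)`
      (∀ ε : ℝ, 0 < ε → ∃ δ : ℝ, 0 < δ ∧
        ∀ x y, rhoEx x y < δ → φ (rhoEx x y) < ε) ∧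
      -- the identity is not bornologous from `(X,ρ)` to `(X,d)`
      ¬ (∀ ε : ℝ, 0 ≤ ε → ∃ δ : ℝ, 0 ≤ δ ∧
          ∀ x y, rhoEx x y ≤ ε → φ (rhoEx x y) ≤ δ) ∧
      -- `d` has no isotone continuation
      ¬ (∃ Ψ : ℝ → ℝ, MonotoneOn Ψ (Set.Ici 0) ∧ (∀ t : ℝ, 0 ≤ t → 0 ≤ Ψ t) ∧
          ∀ x y, φ (rhoEx x y) = Ψ (rhoEx x y)) := by
  have hmem : ∀ x y, rhoEx x y ∈ Set.Ico (0 : ℝ) 1 := fun x y => ⟨rho_nonneg x y, rho_lt x y⟩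
  have hmono : ∀ x y x' y', rhoEx x y ≤ rhoEx x' y' →
      rhoEx x y / (1 - rhoEx x y) ≤ rhoEx x' y' / (1 - rhoEx x' y') :=
    fun x y x' y' h => phi_strict.monotoneOn (hmem x y) (hmem x' y') h
  have hnn : ∀ x y, 0 ≤ rhoEx x y / (1 - rhoEx x y) := fun x y =>
    div_nonneg (rho_nonneg x y) (by linarith [rho_lt x y])
  have hult : ∀ x y z, rhoEx x z / (1 - rhoEx x z) ≤
      max (rhoEx x y / (1 - rhoEx x y)) (rhoEx y z / (1 - rhoEx y z)) := by
    intro x y z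
    rcases le_max_iff.1 (rho_ultra x y z) with h | h
    · exact le_max_of_le_left (hmono _ _ _ _ h)
    · exact le_max_of_le_right (hmono _ _ _ _ h)
  refine ⟨fun t => t / (1 - t), ?_, phi_strict, by simp, ?_, ?_, ?_,
    ⟨⟨rho_nonneg, rho_eq, rho_comm, ?_⟩, rho_ultra⟩, ⟨⟨hnn, ?_, ?_, ?_⟩, hult⟩, hmono,
    ?_, ?_, ?_⟩
  · apply ContinuousOn.div (by fun_prop) (by fun_prop)
    intro x hx
    linarith [hx.2]
  · intro t h0 h1
    exact div_pos h0 (by linarith)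
  · have h1 : Filter.Tendsto (fun t : ℝ => 1 - t) (nhdsWithin 1 (Set.Iio 1))
        (nhdsWithin 0 (Set.Ioi 0)) := by
      apply tendsto_nhdsWithin_iff.2 ⟨?_, ?_⟩
      · have : ContinuousAt (fun t : ℝ => 1 - t) 1 := by fun_prop
        have h := this.tendsto
        simp only [sub_self] at h
        exact h.mono_left nhdsWithin_le_nhds
      · filter_upwards [self_mem_nhdsWithin] with t ht
        exact Set.mem_Ioi.2 (sub_pos.2 (Set.mem_Iio.1 ht))
    have h2 : Filter.Tendsto (fun t : ℝ => t) (nhdsWithin 1 (Set.Iio 1)) (nhds 1) :=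
      nhdsWithin_le_nhds
    have h3 := h2.pos_mul_atTop one_pos h1.inv_tendsto_nhdsGT_zero
    simpa [div_eq_mul_inv] using h3
  · have : ContinuousAt (fun t : ℝ => t / (1 - t)) 0 :=
      ContinuousAt.div (by fun_prop) (by fun_prop) (by norm_num)
    have h := this.tendsto
    simp only [zero_div] at h
    exact h.mono_left nhdsWithin_le_nhds
  · intro x y z
    exact (rho_ultra x y z).trans (max_le_add_of_nonneg (rho_nonneg _ _) (rho_nonneg _ _))
  · intro x y
    have : (1 - rhoEx x y) ≠ 0 := by linarith [rho_lt x y]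
    simp only [div_eq_zero_iff, this, or_false, rho_eq]
  · intro x y
    simp only [rho_comm x y]
  · intro x y z
    exact (hult x y z).trans (max_le_add_of_nonneg (hnn _ _) (hnn _ _))
  · intro ε hε
    refine ⟨ε / (1 + ε), by positivity, fun x y h => ?_⟩
    have h1 := rho_lt x y
    rw [lt_div_iff₀ (by linarith)] at h
    show rhoEx x y / (1 - rhoEx x y) < ε
    rw [div_lt_iff₀ (by linarith)]
    linarith
  · intro h
    obtain ⟨δ, hδ, H⟩ := h 1 zero_le_one
    obtain ⟨x, y, hxy⟩ := phi_large δ hδ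
    exact absurd (H x y (rho_lt x y).le) (not_le.2 hxy)
  · rintro ⟨Ψ, hm, hp, H⟩
    obtain ⟨x, y, hxy⟩ := phi_large (Ψ 1) (hp 1 zero_le_one)
    have h1 := hm (rho_nonneg x y) (Set.mem_Ici.2 zero_le_one) (rho_lt x y).le
    have h2 := H x y
    simp only at h2
    linarith
end

section
/- Let (X₁,d_{X₁}),…,(Xₙ,d_{Xₙ}) be metric spaces such that each (Xᵢ,d_{Xᵢ}) is either unbounded or contains points xᵢ, yᵢ ∈ Xᵢ with d_{Xᵢ}(xᵢ,yᵢ) = diam Xᵢ, where diam Xᵢ = sup{d_{Xᵢ}(x,y) : x, y ∈ Xᵢ}. Then every isotone metric product d on P = X₁ × ⋯ × Xₙ has an isotone continuation, i.e., there exists an isotone function Ψ : ℝ₊ⁿ → ℝ₊ with d((x₁,…,xₙ),(y₁,…,yₙ)) = Ψ(d_{X₁}(x₁,y₁),…,d_{Xₙ}(xₙ,yₙ)) for all points of P. -/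
open scoped NNReal

/-- Corollary 3.7. Let `X₁,…,Xₙ` be metric spaces such that each `Xᵢ` is
either unbounded or attains its diameter. Then every isotone metric product `d` on
`P = X₁ × ⋯ × Xₙ` has an isotone continuation `Ψ : ℝ₊ⁿ → ℝ₊`. -/
theorem stmt_9 (n : ℕ) (hn : 0 < n) (X : Fin n → Type*) [∀ i, MetricSpace (X i)]
    (hX : ∀ i, (¬ Bornology.IsBounded (Set.univ : Set (X i))) ∨
      ∃ x y : X i, edist x y = EMetric.diam (Set.univ : Set (X i)))
    (d : (∀ i, X i) → (∀ i, X i) → ℝ) (hd : IsMetric d)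
    (hprod : ∃ Φ : (Fin n → ℝ≥0) → ℝ≥0,
      MonotoneOn Φ {v : Fin n → ℝ≥0 | ∀ i, ∃ a b : X i, nndist a b = v i} ∧
      ∀ x y : ∀ i, X i, d x y = Φ fun i => nndist (x i) (y i)) :
    ∃ Ψ : (Fin n → ℝ≥0) → ℝ≥0, Monotone Ψ ∧
      ∀ x y : ∀ i, X i, d x y = Ψ fun i => nndist (x i) (y i) := by
  obtain ⟨Φ, hΦ, hdΦ⟩ := hprod
  have key : ∀ (v : Fin n → ℝ≥0) (i : Fin n), ∃ a b : X i, ∀ a' b' : X i,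
      nndist a' b' ≤ v i → nndist a' b' ≤ nndist a b := by
    intro v i
    rcases hX i with h | ⟨x, y, h⟩
    · by_contra hcon
      push Not at hcon
      apply h
      rw [Metric.isBounded_iff]
      refine ⟨v i, fun a _ b _ => ?_⟩
      obtain ⟨a', b', h1, h2⟩ := hcon a b
      exact_mod_cast (h2.le.trans h1)
    · refine ⟨x, y, fun a' b' _ => ?_⟩
      have h3 : edist a' b' ≤ edist x y := by
        rw [h]
        exact Metric.edist_le_ediam_of_mem (Set.mem_univ _) (Set.mem_univ _)
      rw [edist_nndist, edist_nndist] at h3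
      exact_mod_cast h3
  let A : Set (Fin n → ℝ≥0) := {v | ∀ i, ∃ a b : X i, nndist a b = v i}
  have hbdd : ∀ v, BddAbove (Φ '' {u | u ∈ A ∧ u ≤ v}) := by
    intro v
    choose a b hab using key v
    refine ⟨Φ fun i => nndist (a i) (b i), ?_⟩
    rintro _ ⟨u, ⟨hu, huv⟩, rfl⟩
    refine hΦ hu (fun i => ⟨a i, b i, rfl⟩) fun i => ?_
    obtain ⟨a', b', h⟩ := hu i
    have h2 := hab i a' b' (h.le.trans (huv i))
    rwa [h] at h2
  have hne : ∀ v, (Φ '' {u | u ∈ A ∧ u ≤ v}).Nonempty := by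
    intro v
    refine ⟨_, 0, ⟨fun i => ?_, fun i => zero_le⟩, rfl⟩
    obtain ⟨a, b, _⟩ := key v i
    exact ⟨a, a, nndist_self a⟩
  refine ⟨fun v => sSup (Φ '' {u | u ∈ A ∧ u ≤ v}), fun v w hvw => ?_, fun x y => ?_⟩
  · exact csSup_le_csSup (hbdd w) (hne v)
      (Set.image_mono fun u hu => ⟨hu.1, hu.2.trans hvw⟩)
  · rw [hdΦ x y]
    have hmem : (fun i => nndist (x i) (y i)) ∈ A := fun i => ⟨x i, y i, rfl⟩
    congr 1
    apply le_antisymm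
    · exact le_csSup (hbdd _) ⟨_, ⟨hmem, le_rfl⟩, rfl⟩
    · apply csSup_le (hne _)
      rintro _ ⟨u, ⟨hu, huv⟩, rfl⟩
      exact hΦ hu hmem huv
end

section
/- Let (X₁,d_{X₁}),…,(Xₙ,d_{Xₙ}) be metric spaces and let d be a metric on P = X₁ × ⋯ × Xₙ. Then the following are equivalent: (i) d is an isotone metric product and there exists an isotone amenable function Ψ : ℝ₊ⁿ → ℝ₊ with d((x₁,…,xₙ),(y₁,…,yₙ)) = Ψ(d_{X₁}(x₁,y₁),…,d_{Xₙ}(xₙ,yₙ)) for all points of P; (ii) d is distance-increasing, the identity map of P is bornologous as a map from (P,ρ∞) to (P,d), and the identity map of P is uniformly continuous as a map from (P,d) to (P,ρ∞), where ρ∞ is the maximum metric ρ∞((x₁,…,xₙ),(y₁,…,yₙ)) = max_{1 ≤ i ≤ n} d_{Xᵢ}(xᵢ,yᵢ). -/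
open scoped NNReal

/-- Theorem 3.8. For metric spaces `X₁,…,Xₙ` and a metric `d` on
`P = X₁ × ⋯ × Xₙ`, the following are equivalent: (i) `d` is an isotone metric product and
has an isotone amenable continuation `Ψ : ℝ₊ⁿ → ℝ₊`; (ii) `d` is distance-increasing, the
identity is bornologous from `(P,ρ∞)` to `(P,d)`, and the identity is uniformly continuous
from `(P,d)` to `(P,ρ∞)`, where `ρ∞` is the maximum metric. -/
theorem stmt_10 (n : ℕ) (hn : 0 < n) (X : Fin n → Type*) [∀ i, MetricSpace (X i)]
    (d : (∀ i, X i) → (∀ i, X i) → ℝ) (hd : IsMetric d) :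
    ((∃ Φ : (Fin n → ℝ≥0) → ℝ≥0,
        MonotoneOn Φ {v : Fin n → ℝ≥0 | ∀ i, ∃ a b : X i, nndist a b = v i} ∧
        ∀ x y : ∀ i, X i, d x y = Φ fun i => nndist (x i) (y i)) ∧
      (∃ Ψ : (Fin n → ℝ≥0) → ℝ≥0, Monotone Ψ ∧
        (Ψ 0 = 0 ∧ ∀ v : Fin n → ℝ≥0, v ≠ 0 → 0 < Ψ v) ∧
        ∀ x y : ∀ i, X i, d x y = Ψ fun i => nndist (x i) (y i))) ↔
      ((∀ x y x' y' : ∀ i, X i,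
          (∀ i, dist (x i) (y i) ≤ dist (x' i) (y' i)) → d x y ≤ d x' y') ∧
        (∀ ε : ℝ, 0 ≤ ε → ∃ δ : ℝ, 0 ≤ δ ∧ ∀ x y : ∀ i, X i,
          ((Finset.univ.sup (fun i => nndist (x i) (y i)) : ℝ≥0) : ℝ) ≤ ε → d x y ≤ δ) ∧
        (∀ ε : ℝ, 0 < ε → ∃ δ : ℝ, 0 < δ ∧ ∀ x y : ∀ i, X i,
          d x y < δ →
            ((Finset.univ.sup (fun i => nndist (x i) (y i)) : ℝ≥0) : ℝ) < ε)) := by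
  classical
  obtain ⟨hnn, hz, -, -⟩ := hd
  constructor
  · rintro ⟨-, Ψ, hm, ⟨h0, hpos⟩, hΨ⟩
    refine ⟨?_, ?_, ?_⟩
    · intro x y x' y' h
      rw [hΨ, hΨ]
      exact_mod_cast hm (fun i => by exact_mod_cast h i)
    · intro ε hε
      lift ε to ℝ≥0 using hε
      refine ⟨Ψ (fun _ => ε), NNReal.coe_nonneg _, fun x y h => ?_⟩
      rw [hΨ]
      have h' : Finset.univ.sup (fun i => nndist (x i) (y i)) ≤ ε := h
      rw [Finset.sup_le_iff] at h'
      exact_mod_cast hm (fun i => h' i (Finset.mem_univ i))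
    · intro ε hε
      have hne : (Finset.univ : Finset (Fin n)).Nonempty := ⟨⟨0, hn⟩, Finset.mem_univ _⟩
      lift ε to ℝ≥0 using hε.le
      have hε' : 0 < ε := hε
      refine ⟨((Finset.univ.inf' hne
        (fun i => Ψ (Pi.single i ε)) : ℝ≥0) : ℝ), ?_, ?_⟩
      · rw [NNReal.coe_pos, Finset.lt_inf'_iff]
        intro i _
        apply hpos
        rw [Ne, Pi.single_eq_zero_iff]
        exact hε'.ne'
      · intro x y h
        rw [hΨ, NNReal.coe_lt_coe, Finset.lt_inf'_iff] at h
        have : Finset.univ.sup (fun i => nndist (x i) (y i)) < ε := by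
          rw [Finset.sup_lt_iff (by simpa using hε')]
          intro i hi
          by_contra hc
          push Not at hc
          refine absurd (h i hi) (not_lt.2 (hm ?_))
          intro j
          by_cases hj : j = i
          · subst hj
            simpa using hc
          · simp [hj]
        exact this
  · rintro ⟨hinc, hb, hu⟩
    obtain ⟨D, hD⟩ : ∃ D : (∀ i, X i) → (∀ i, X i) → ℝ≥0, ∀ x y, d x y = D x y :=
      ⟨fun x y => ⟨d x y, hnn x y⟩, fun _ _ => rfl⟩
    let ρ : (∀ i, X i) → (∀ i, X i) → ℝ≥0 :=
      fun x y => Finset.univ.sup (fun i => nndist (x i) (y i))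
    let S : (Fin n → ℝ≥0) → Set ℝ≥0 :=
      fun v => {r | ∃ x y, (∀ i, nndist (x i) (y i) ≤ v i) ∧ D x y = r}
    let T : ℝ≥0 → Set ℝ≥0 := fun t => insert t {r | ∃ x y, t ≤ ρ x y ∧ D x y = r}
    have hSb : ∀ v, BddAbove (S v) := by
      intro v
      obtain ⟨δ, hδ, h⟩ := hb (Finset.univ.sup v : ℝ≥0) (NNReal.coe_nonneg _)
      refine ⟨⟨δ, hδ⟩, ?_⟩
      rintro r ⟨x, y, hxy, rfl⟩
      have := h x y (by
        rw [NNReal.coe_le_coe]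
        exact Finset.sup_mono_fun (fun i _ => hxy i))
      rw [hD] at this
      exact this
    have hTne : ∀ t, (T t).Nonempty := fun t => ⟨t, Set.mem_insert _ _⟩
    let Ψ : (Fin n → ℝ≥0) → ℝ≥0 := fun v => max (sSup (S v)) (sInf (T (Finset.univ.sup v)))
    have hmono : Monotone Ψ := by
      intro v w hvw
      apply max_le_max
      · by_cases hne : (S v).Nonempty
        · apply csSup_le_csSup (hSb w) hne
          rintro r ⟨x, y, hxy, rfl⟩
          exact ⟨x, y, fun i => (hxy i).trans (hvw i), rfl⟩
        · rw [Set.not_nonempty_iff_eq_empty.1 hne]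
          simp
      · have hs : Finset.univ.sup v ≤ Finset.univ.sup w :=
          Finset.sup_mono_fun (fun i _ => hvw i)
        apply le_csInf (hTne _)
        rintro r (rfl | ⟨x, y, hxy, rfl⟩)
        · exact (csInf_le (OrderBot.bddBelow _) (Set.mem_insert _ _)).trans hs
        · exact csInf_le (OrderBot.bddBelow _) (Or.inr ⟨x, y, hs.trans hxy, rfl⟩)
    have heq : ∀ x y : ∀ i, X i, d x y = Ψ fun i => nndist (x i) (y i) := by
      intro x y
      rw [hD, NNReal.coe_inj]
      apply le_antisymm
      · exact le_max_of_le_left (le_csSup (hSb _) ⟨x, y, fun i => le_rfl, rfl⟩)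
      · apply max_le
        · apply csSup_le'
          rintro r ⟨x', y', h, rfl⟩
          have := hinc x' y' x y (fun i => by exact_mod_cast h i)
          rw [hD, hD] at this
          exact_mod_cast this
        · exact csInf_le (OrderBot.bddBelow _) (Or.inr ⟨x, y, le_rfl, rfl⟩)
    have h0 : Ψ 0 = 0 := by
      apply le_antisymm _ zero_le
      apply max_le
      · apply csSup_le'
        rintro r ⟨x, y, h, rfl⟩
        have hxy : x = y := by
          funext i
          have := h i
          simpa using this
        have := (hz x y).2 hxy
        rw [hD] at this
        exact_mod_cast this.le
      · refine (csInf_le (OrderBot.bddBelow _) (Set.mem_insert _ _)).trans ?_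
        simp
    have hpos : ∀ v : Fin n → ℝ≥0, v ≠ 0 → 0 < Ψ v := by
      intro v hv
      obtain ⟨i, hi⟩ := Function.ne_iff.1 hv
      have ht : 0 < Finset.univ.sup v :=
        (pos_iff_ne_zero.2 hi).trans_le (Finset.le_sup (Finset.mem_univ i))
      obtain ⟨δ, hδ, h⟩ := hu (Finset.univ.sup v : ℝ≥0) ht
      lift δ to ℝ≥0 using hδ.le
      have hδ' : 0 < δ := hδ
      apply lt_max_of_lt_right
      refine (lt_min ht hδ').trans_le (le_csInf (hTne _) ?_)
      rintro r (rfl | ⟨x, y, hxy, rfl⟩)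
      · exact min_le_left _ _
      · apply min_le_of_right_le
        by_contra hc
        have h1 := h x y (by rw [hD]; exact_mod_cast not_le.1 hc)
        rw [NNReal.coe_lt_coe] at h1
        exact absurd hxy (not_le.2 h1)
    exact ⟨⟨Ψ, hmono.monotoneOn _, heq⟩, Ψ, hmono, ⟨h0, hpos⟩, heq⟩
end

section
/- Let (X₁,d_{X₁}),…,(Xₙ,d_{Xₙ}) be nonempty metric spaces. If d is an isotone subadditive metric product on P = X₁ × ⋯ × Xₙ, then the identity map of P is bornologous as a map from (P,ρ∞) to (P,d) and uniformly continuous as a map from (P,d) to (P,ρ∞), where ρ∞((x₁,…,xₙ),(y₁,…,yₙ)) = max_{1 ≤ i ≤ n} d_{Xᵢ}(xᵢ,yᵢ). -/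
open scoped NNReal

theorem sub_aux {n : ℕ} {A : Set (Fin n → ℝ≥0)} {Φ : (Fin n → ℝ≥0) → ℝ≥0}
    (h : SubadditiveOnSet n A Φ) {m : ℕ} (hm : 2 ≤ m) {x a : Fin n → ℝ≥0} (hx : x ∈ A)
    (ha : a ∈ A) (hxa : ∀ i, x i ≤ m * a i) : Φ x ≤ m * Φ a := by
  have := h m hm x hx (fun _ => a) (fun _ => ha) (by
    intro i
    simpa using hxa i)
  simpa using this

theorem arch_aux (c e : ℝ≥0) (he : 0 < e) : ∃ m : ℕ, ∀ k : ℕ, m ≤ k → c ≤ k * e := by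
  obtain ⟨m, hm⟩ := exists_nat_ge (c / e)
  refine ⟨m, fun k hk => ?_⟩
  have : c / e ≤ k := hm.trans (by exact_mod_cast hk)
  exact (div_le_iff₀ he).1 this

/-- Corollary 3.10. For nonempty metric spaces `X₁,…,Xₙ`, if `d` is an
isotone subadditive metric product on `P = X₁ × ⋯ × Xₙ`, then the identity map of `P` is
bornologous from `(P,ρ∞)` to `(P,d)` and uniformly continuous from `(P,d)` to `(P,ρ∞)`,
where `ρ∞` is the maximum metric. -/
theorem stmt_12 (n : ℕ) (hn : 0 < n) (X : Fin n → Type*) [∀ i, MetricSpace (X i)]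
    [∀ i, Nonempty (X i)]
    (d : (∀ i, X i) → (∀ i, X i) → ℝ) (hd : IsMetric d)
    (hprod : ∃ Φ : (Fin n → ℝ≥0) → ℝ≥0,
      MonotoneOn Φ {v : Fin n → ℝ≥0 | ∀ i, ∃ a b : X i, nndist a b = v i} ∧
      SubadditiveOnSet n {v : Fin n → ℝ≥0 | ∀ i, ∃ a b : X i, nndist a b = v i} Φ ∧
      ∀ x y : ∀ i, X i, d x y = Φ fun i => nndist (x i) (y i)) :
    (∀ ε : ℝ, 0 ≤ ε → ∃ δ : ℝ, 0 ≤ δ ∧ ∀ x y : ∀ i, X i,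
      ((Finset.univ.sup (fun i => nndist (x i) (y i)) : ℝ≥0) : ℝ) ≤ ε → d x y ≤ δ) ∧
    (∀ ε : ℝ, 0 < ε → ∃ δ : ℝ, 0 < δ ∧ ∀ x y : ∀ i, X i,
      d x y < δ → ((Finset.univ.sup (fun i => nndist (x i) (y i)) : ℝ≥0) : ℝ) < ε) := by
  classical
  obtain ⟨Φ, -, hsub, hΦ⟩ := hprod
  set A : Set (Fin n → ℝ≥0) := {v | ∀ i, ∃ a b : X i, nndist a b = v i} with hA
  constructor
  · intro ε hε
    lift ε to ℝ≥0 using hε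
    have key : ∀ i, ∃ a b : X i, ∃ m : ℕ, ∀ k : ℕ, m ≤ k → ∀ s t : X i,
        nndist s t ≤ ε → nndist s t ≤ k * nndist a b := by
      intro i
      by_cases hs : ∃ a b : X i, a ≠ b
      · obtain ⟨a, b, hab⟩ := hs
        obtain ⟨m, hm⟩ := arch_aux ε (nndist a b)
          (pos_iff_ne_zero.2 fun h => hab (nndist_eq_zero.1 h))
        exact ⟨a, b, m, fun k hk s t hst => hst.trans (hm k hk)⟩
      · push Not at hs
        obtain ⟨p⟩ : Nonempty (X i) := inferInstance
        refine ⟨p, p, 0, fun k _ s t _ => ?_⟩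
        rw [hs s t]
        simp
    choose a b m hm using key
    refine ⟨((Finset.univ.sup m + 2 : ℕ) : ℝ≥0) * Φ (fun i => nndist (a i) (b i)),
      by positivity, fun x y hxy => ?_⟩
    rw [hΦ]
    have hxy' : Finset.univ.sup (fun i => nndist (x i) (y i)) ≤ ε := by exact_mod_cast hxy
    have := sub_aux hsub (m := Finset.univ.sup m + 2) (by omega)
      (x := fun i => nndist (x i) (y i)) (a := fun i => nndist (a i) (b i))
      (fun i => ⟨_, _, rfl⟩) (fun i => ⟨_, _, rfl⟩) (fun i => by
        refine hm i _ ?_ _ _ ?_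
        · exact (Finset.le_sup (f := m) (Finset.mem_univ i)).trans (by omega)
        · exact (Finset.le_sup (f := fun i => nndist (x i) (y i)) (Finset.mem_univ i)).trans hxy')
    exact_mod_cast this
  · intro ε hε
    lift ε to ℝ≥0 using hε.le
    have hε' : 0 < ε := by exact_mod_cast hε
    have key : ∀ i, ∃ δ : ℝ, 0 < δ ∧ ∀ x y : ∀ i, X i, ε ≤ nndist (x i) (y i) → δ ≤ d x y := by
      intro i
      by_cases hs : ∃ a b : X i, a ≠ b
      · obtain ⟨a, b, hab⟩ := hs
        obtain ⟨m, hm⟩ := arch_aux (nndist a b) ε hε'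
        obtain ⟨p⟩ : Nonempty (∀ i, X i) := inferInstance
        have hpos : 0 < d (Function.update p i a) (Function.update p i b) := by
          refine lt_of_le_of_ne (hd.1 _ _) fun h => hab ?_
          have := congrFun ((hd.2.1 _ _).1 h.symm) i
          simpa using this
        refine ⟨d (Function.update p i a) (Function.update p i b) / ((m + 2 : ℕ) : ℝ),
          by positivity, fun x y hxy => ?_⟩
        rw [div_le_iff₀ (by positivity), mul_comm, hΦ, hΦ]
        have := sub_aux hsub (m := m + 2) (by omega)
          (x := fun j => nndist (Function.update p i a j) (Function.update p i b j))
          (a := fun i => nndist (x i) (y i))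
          (fun i => ⟨_, _, rfl⟩) (fun i => ⟨_, _, rfl⟩) (fun j => by
            by_cases hj : j = i
            · subst hj
              simp only [Function.update_self]
              exact (hm (m + 2) (by omega)).trans (by gcongr)
            · simp [Function.update_of_ne hj])
        exact_mod_cast this
      · push Not at hs
        refine ⟨1, one_pos, fun x y hxy => ?_⟩
        rw [hs (x i) (y i), nndist_self] at hxy
        exact absurd hxy (not_le.2 hε')
    choose δ hδ hδ2 using key
    have hne : (Finset.univ : Finset (Fin n)).Nonempty := ⟨⟨0, hn⟩, Finset.mem_univ _⟩
    refine ⟨Finset.univ.inf' hne δ, (Finset.lt_inf'_iff hne).2 fun i _ => hδ i,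
      fun x y hxy => ?_⟩
    have : Finset.univ.sup (fun i => nndist (x i) (y i)) < ε := by
      refine (Finset.sup_lt_iff (by simpa using hε')).2 fun i _ => ?_
      by_contra hc
      have h1 := hδ2 i x y (not_lt.1 hc)
      have h2 := Finset.inf'_le δ (Finset.mem_univ i)
      linarith
    exact_mod_cast this
end

section
/- Let n be a positive integer and let Φ : ℝ₊ⁿ → ℝ₊ be an isotone function. Then the following four conditions are equivalent: (i) Φ(d_{X₁}(·,·),…,d_{Xₙ}(·,·)) is a metric on X₁ × ⋯ × Xₙ for all metric spaces (X₁,d_{X₁}),…,(Xₙ,d_{Xₙ}); (ii) Φ(|x₁ − y₁|,…,|xₙ − yₙ|) is a metric on ℝⁿ, where each factor is ℝ with the usual metric; (iii) Φ(d_{X₁}(·,·),…,d_{Xₙ}(·,·)) is a metric on X₁ × ⋯ × Xₙ for all three-point subspaces X₁,…,Xₙ of ℝ with the usual metric |x − y|; (iv) there exist 3l-universal metric spaces (X₁,d_{X₁}),…,(Xₙ,d_{Xₙ}) such that Φ(d_{X₁}(·,·),…,d_{Xₙ}(·,·)) is a metric on X₁ × ⋯ × Xₙ. -/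
open scoped NNReal

/-- The function `Φ(d₁(·,·),…,dₙ(·,·))` is a metric on the product `X₁ × ⋯ × Xₙ`. -/
def ProductIsMetric {n : ℕ} (Φ : (Fin n → ℝ≥0) → ℝ≥0) (X : Fin n → Type*)
    [∀ i, MetricSpace (X i)] : Prop :=
  IsMetric (fun x y : ∀ i, X i => ((Φ fun i => nndist (x i) (y i) : ℝ≥0) : ℝ))

/-- A metric space is `3l`-universal if every three-point subspace of the real line embeds
isometrically into it: for all `a, b ≥ 0` there are points `x₁, x₂, x₃` with
`d(x₁,x₂) = a`, `d(x₂,x₃) = b` and `d(x₁,x₃) = a + b`. -/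
def Is3lUniversal (α : Type*) [MetricSpace α] : Prop :=
  ∀ a b : ℝ, 0 ≤ a → 0 ≤ b →
    ∃ x₁ x₂ x₃ : α, dist x₁ x₂ = a ∧ dist x₂ x₃ = b ∧ dist x₁ x₃ = a + b

theorem aux_of_points {n : ℕ} {Φ : (Fin n → ℝ≥0) → ℝ≥0} {X : Fin n → Type}
    [m : ∀ i, MetricSpace (X i)] (h : ProductIsMetric Φ X) (a b : Fin n → ℝ≥0)
    (hx : ∀ i, ∃ x y z : X i, nndist x y = a i ∧ nndist y z = b i ∧ nndist x z = a i + b i) :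
    (Φ a = 0 ↔ a = 0) ∧ Φ (a + b) ≤ Φ a + Φ b := by
  choose x y z h1 h2 h3 using hx
  obtain ⟨-, hz, -, ht⟩ := h
  have ea : (fun i => nndist (x i) (y i)) = a := funext h1
  have eb : (fun i => nndist (y i) (z i)) = b := funext h2
  have ec : (fun i => nndist (x i) (z i)) = a + b := funext h3
  constructor
  · have := hz x y
    simp only [ea, NNReal.coe_eq_zero] at this
    rw [this]
    constructor
    · intro e
      rw [← ea, e]
      ext i
      simp
    · intro e
      funext i
      have := h1 i
      rw [e] at this
      simpa using this
  · have := ht x y z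
    simp only [ea, eb, ec] at this
    exact_mod_cast this

theorem aux_to_all {n : ℕ} {Φ : (Fin n → ℝ≥0) → ℝ≥0} (hΦ : Monotone Φ)
    (h : ∀ a b, (Φ a = 0 ↔ a = 0) ∧ Φ (a + b) ≤ Φ a + Φ b)
    (X : Fin n → Type) (m : ∀ i, MetricSpace (X i)) : ProductIsMetric Φ X := by
  refine ⟨fun x y => NNReal.coe_nonneg _, fun x y => ?_, fun x y => ?_, fun x y z => ?_⟩
  · rw [NNReal.coe_eq_zero, (h _ 0).1]
    simp [funext_iff]
  · simp only [nndist_comm]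
  · have h1 : Φ (fun i => nndist (x i) (z i)) ≤
        Φ ((fun i => nndist (x i) (y i)) + (fun i => nndist (y i) (z i))) :=
      hΦ fun i => nndist_triangle _ _ _
    exact_mod_cast h1.trans (h _ _).2

theorem aux_univ {α : Type} [MetricSpace α] (h : Is3lUniversal α) (a b : ℝ≥0) :
    ∃ x y z : α, nndist x y = a ∧ nndist y z = b ∧ nndist x z = a + b := by
  obtain ⟨x, y, z, h1, h2, h3⟩ := h a b a.2 b.2
  exact ⟨x, y, z, NNReal.eq h1, NNReal.eq h2, NNReal.eq h3⟩

theorem aux_real : Is3lUniversal ℝ := by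
  intro a b ha hb
  refine ⟨0, a, a + b, ?_, ?_, ?_⟩
  · simp [abs_of_nonneg ha]
  · simp [abs_of_nonneg hb]
  · rw [dist_comm, Real.dist_eq, sub_zero, abs_of_nonneg (add_nonneg ha hb)]

theorem aux_set (x y z : ℝ) : ∃ S : Set ℝ, S.ncard = 3 ∧ x ∈ S ∧ y ∈ S ∧ z ∈ S := by
  classical
  obtain ⟨t, ht, hc⟩ := Infinite.exists_superset_card_eq ({x, y, z} : Finset ℝ) 3
    Finset.card_le_three
  refine ⟨t, by rw [Set.ncard_coe_finset, hc], ?_, ?_, ?_⟩ <;>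
    exact ht (by simp)

/-- Theorem 5.1. For an isotone `Φ : ℝ₊ⁿ → ℝ₊` the following are
equivalent: (i) `Φ(d₁,…,dₙ)` is a metric on every product of metric spaces; (ii) it is a
metric on `ℝⁿ` (usual metric in every factor); (iii) it is a metric on every product of
three-point subspaces of `ℝ`; (iv) it is a metric on some product of `3l`-universal metric
spaces. -/
theorem stmt_16 (n : ℕ) (hn : 0 < n) (Φ : (Fin n → ℝ≥0) → ℝ≥0) (hΦ : Monotone Φ) :
    List.TFAE
      [∀ (X : Fin n → Type) (m : ∀ i, MetricSpace (X i)), @ProductIsMetric n Φ X m,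
        ProductIsMetric Φ (fun _ : Fin n => ℝ),
        ∀ S : Fin n → Set ℝ, (∀ i, (S i).ncard = 3) →
          ProductIsMetric Φ (fun i => ↥(S i)),
        ∃ (X : Fin n → Type) (m : ∀ i, MetricSpace (X i)),
          (∀ i, @Is3lUniversal (X i) (m i)) ∧ @ProductIsMetric n Φ X m] := by
  tfae_have 1 → 2 := fun h => h _ _
  tfae_have 1 → 3 := fun h S _ => h _ _
  tfae_have 2 → 4 := fun h => ⟨fun _ => ℝ, fun _ => inferInstance, fun _ => aux_real, h⟩
  tfae_have 4 → 1 := by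
    rintro ⟨X, m, hu, h⟩
    exact aux_to_all hΦ fun a b => aux_of_points h a b fun i => aux_univ (hu i) _ _
  tfae_have 3 → 1 := by
    intro h
    refine aux_to_all hΦ fun a b => ?_
    choose x y z hx using fun i => aux_univ aux_real (a i) (b i)
    choose S hS h1 h2 h3 using fun i => aux_set (x i) (y i) (z i)
    exact aux_of_points (h S hS) a b fun i =>
      ⟨⟨x i, h1 i⟩, ⟨y i, h2 i⟩, ⟨z i, h3 i⟩, hx i⟩
  tfae_finish
end

section
/- Let X be a linear subspace of ℝ regarded as a vector space over the field ℚ of rational numbers. If ℝ \ X is nonempty, then the set ℝ \ X, equipped with the metric inherited from ℝ (d(x,y) = |x − y|), is 3l-universal: for all a, b ∈ ℝ₊ there exist x₀, y₀, z₀ ∈ ℝ \ X with x₀ − y₀ = a and y₀ − z₀ = b (hence |x₀ − y₀| = a, |y₀ − z₀| = b and |x₀ − z₀| = a + b). -/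
/-- Proposition 5.3. Let `X` be a `ℚ`-linear subspace of `ℝ`. If
`ℝ \ X` is nonempty, then `ℝ \ X` (with the metric `|x − y|`) is `3l`-universal: for all
`a, b ≥ 0` there are `x₀, y₀, z₀ ∉ X` with `x₀ − y₀ = a` and `y₀ − z₀ = b` (hence
`|x₀ − y₀| = a`, `|y₀ − z₀| = b` and `|x₀ − z₀| = a + b`). -/
theorem stmt_17 (X : Submodule ℚ ℝ) (hX : ∃ r : ℝ, r ∉ X) :
    ∀ a b : ℝ, 0 ≤ a → 0 ≤ b →
      ∃ x₀ y₀ z₀ : ℝ, x₀ ∉ X ∧ y₀ ∉ X ∧ z₀ ∉ X ∧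
        x₀ - y₀ = a ∧ y₀ - z₀ = b ∧
        |x₀ - y₀| = a ∧ |y₀ - z₀| = b ∧ |x₀ - z₀| = a + b := by
  obtain ⟨r, hr⟩ := hX
  intro a b ha hb
  have key : ∀ t : ℝ, {q : ℚ | q • r + t ∈ X}.Finite := by
    intro t
    apply Set.Subsingleton.finite
    intro p hp q hq
    by_contra hne
    apply hr
    have h1 : (p - q) • r ∈ X := by
      have h := X.sub_mem hp hq
      rwa [add_sub_add_right_eq_sub, ← sub_smul] at h
    exact (X.smul_mem_iff (sub_ne_zero.mpr hne)).mp h1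
  obtain ⟨q, hq⟩ := (((key a).union (key 0)).union (key (-b))).exists_notMem
  simp only [Set.mem_union, Set.mem_setOf_eq, not_or] at hq
  obtain ⟨⟨h1, h2⟩, h3⟩ := hq
  have e1 : q • r + a - (q • r + 0) = a := by ring
  have e2 : q • r + 0 - (q • r + -b) = b := by ring
  have e3 : q • r + a - (q • r + -b) = a + b := by ring
  refine ⟨_, _, _, h1, h2, h3, e1, e2, ?_, ?_, ?_⟩
  · rw [e1, abs_of_nonneg ha]
  · rw [e2, abs_of_nonneg hb]
  · rw [e3, abs_of_nonneg (add_nonneg ha hb)]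
end

section
/- Let X be a linear subspace of ℝ regarded as a vector space over the field ℚ of rational numbers, equipped with the metric inherited from ℝ (d(x,y) = |x − y|). Then X is 3l-universal if and only if X = ℝ. -/
/-- Proposition 5.6. A `ℚ`-linear subspace `X` of `ℝ`, with the metric
`|x − y|` inherited from `ℝ`, is `3l`-universal iff `X = ℝ`. -/
theorem stmt_18 (X : Submodule ℚ ℝ) :
    (∀ a b : ℝ, 0 ≤ a → 0 ≤ b →
        ∃ x₁ x₂ x₃ : ℝ, x₁ ∈ X ∧ x₂ ∈ X ∧ x₃ ∈ X ∧
          |x₁ - x₂| = a ∧ |x₂ - x₃| = b ∧ |x₁ - x₃| = a + b) ↔ X = ⊤ := by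
  constructor
  · intro h
    rw [Submodule.eq_top_iff']
    intro r
    obtain ⟨x, y, z, hx, hy, _, hxy, _, _⟩ := h |r| 0 (abs_nonneg r) le_rfl
    have hd : x - y ∈ X := X.sub_mem hx hy
    rcases abs_eq_abs.mp hxy with h1 | h1
    · rw [← h1]
      exact hd
    · have h2 : r = -(x - y) := by linarith
      rw [h2]
      exact X.neg_mem hd
  · rintro rfl a b ha hb
    refine ⟨0, a, a + b, Submodule.mem_top, Submodule.mem_top, Submodule.mem_top, ?_, ?_, ?_⟩
    · rw [zero_sub, abs_neg, abs_of_nonneg ha]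
    · rw [sub_add_cancel_left, abs_neg, abs_of_nonneg hb]
    · rw [zero_sub, abs_neg, abs_of_nonneg (add_nonneg ha hb)]
end
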